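/- arXiv:cs/0607132 — 4 statements merged into one kernel-verified Lean document; each statement's English description precedes it below -/
import Mathlib

section
/- Let q ≥ 2, n ≥ 1 and ℓ ≥ 0 be integers and let Q = {0,1,…,q−1}. A code C ⊆ Q^n is an ℓ-UEC code (i.e., for all distinct x, y ∈ C there is no word z ∈ Q^n with z = x + e or z = x − e for some e ∈ {0,1,…,ℓ}^n and simultaneously z = y + f or z = y − f for some f ∈ {0,1,…,ℓ}^n) if and only if d_u(x,y) ≥ 2ℓ + 1 for all distinct x, y ∈ C. -/
open Finset Filter

/-- `x` is a word over the alphabet `Q = {0,1,…,q-1}`. -/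
def inQ (q : ℤ) {n : ℕ} (x : Fin n → ℤ) : Prop :=
  ∀ i, 0 ≤ x i ∧ x i ≤ q - 1

/-- `d(x,y) = max_i |x_i - y_i|`. -/
def dmax {n : ℕ} (x y : Fin n → ℤ) : ℤ :=
  ((Finset.univ.sup fun i => (x i - y i).natAbs : ℕ) : ℤ)

/-- `d_u(x,y)`: equals `d(x,y)` if `x ≥ y` or `y ≥ x`, and `2·d(x,y)` otherwise. -/
def du {n : ℕ} (x y : Fin n → ℤ) : ℤ :=
  if (∀ i, y i ≤ x i) ∨ (∀ i, x i ≤ y i) then dmax x y else 2 * dmax x y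

/-- Maximum size of an `ℓ`-AEC code in `Q^n`. -/
noncomputable def Aa (q : ℤ) (n : ℕ) (ℓ : ℤ) : ℕ :=
  sSup {k : ℕ | ∃ C : Finset (Fin n → ℤ), (∀ x ∈ C, inQ q x) ∧
    (∀ x ∈ C, ∀ y ∈ C, x ≠ y → ℓ + 1 ≤ dmax x y) ∧ C.card = k}

/-- Maximum size of an `ℓ`-UEC code in `Q^n`. -/
noncomputable def Au (q : ℤ) (n : ℕ) (ℓ : ℤ) : ℕ :=
  sSup {k : ℕ | ∃ C : Finset (Fin n → ℤ), (∀ x ∈ C, inQ q x) ∧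
    (∀ x ∈ C, ∀ y ∈ C, x ≠ y → 2 * ℓ + 1 ≤ du x y) ∧ C.card = k}

/-- `C` is a code of Varshamov–Tenengolts type: the solution set in `Q^n`
of a linear equation `Σ aᵢ xᵢ = a` over `ℤ`. -/
def IsVT (q : ℤ) {n : ℕ} (C : Finset (Fin n → ℤ)) : Prop :=
  ∃ (coef : Fin n → ℤ) (a : ℤ),
    ∀ x : Fin n → ℤ, x ∈ C ↔ (inQ q x ∧ ∑ i, coef i * x i = a)

/-- Maximum size of a VT-type `ℓ`-AEC code in `Q^n`. -/
noncomputable def LAa (q : ℤ) (n : ℕ) (ℓ : ℤ) : ℕ :=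
  sSup {k : ℕ | ∃ C : Finset (Fin n → ℤ), IsVT q C ∧
    (∀ x ∈ C, ∀ y ∈ C, x ≠ y → ℓ + 1 ≤ dmax x y) ∧ C.card = k}

/-- Maximum size of a VT-type `ℓ`-UEC code in `Q^n`. -/
noncomputable def LAu (q : ℤ) (n : ℕ) (ℓ : ℤ) : ℕ :=
  sSup {k : ℕ | ∃ C : Finset (Fin n → ℤ), IsVT q C ∧
    (∀ x ∈ C, ∀ y ∈ C, x ≠ y → 2 * ℓ + 1 ≤ du x y) ∧ C.card = k}

/-- `γ_n(r) = |C_n(r)|` where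
`C_n(r) = {x ∈ Q^n : Σ (ℓ+1)^i x_i = α·S_n + r}`, `α = ⌊(q-1)/2⌋`,
`S_n = Σ_{i<n} (ℓ+1)^i`. -/
noncomputable def gam (q ℓ : ℤ) (n : ℕ) (r : ℤ) : ℕ :=
  Set.ncard {x : Fin n → ℤ | inQ q x ∧
    ∑ i : Fin n, (ℓ + 1) ^ (i : ℕ) * x i
      = ((q - 1) / 2) * (∑ i ∈ Finset.range n, (ℓ + 1) ^ i) + r}

theorem dmax_le_iff {n : ℕ} (x y : Fin n → ℤ) {k : ℤ} (hk : 0 ≤ k) :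
    dmax x y ≤ k ↔ ∀ i, |x i - y i| ≤ k := by
  lift k to ℕ using hk
  simp only [dmax, Nat.cast_le, Finset.sup_le_iff, Finset.mem_univ, true_implies]
  exact forall_congr' fun i => by rw [Int.abs_eq_natAbs, Nat.cast_le]

theorem du_le_two_mul_iff {n : ℕ} (x y : Fin n → ℤ) {ℓ : ℤ} (hℓ : 0 ≤ ℓ) :
    du x y ≤ 2 * ℓ ↔
      (((∀ i, y i ≤ x i) ∨ (∀ i, x i ≤ y i)) ∧ ∀ i, |x i - y i| ≤ 2 * ℓ) ∨
        ∀ i, |x i - y i| ≤ ℓ := by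
  rw [← dmax_le_iff x y hℓ, ← dmax_le_iff x y (by lia : 0 ≤ 2 * ℓ), du]
  have h : 0 ≤ dmax x y := Int.natCast_nonneg _
  split_ifs with hxy
  · simp only [hxy, true_and]
    lia
  · simp only [hxy, false_and, false_or]
    lia

/-- Comparable words meet at their midpoint, and incomparable ones at their coordinatewise
maximum. -/
theorem exists_common_word_iff {q : ℤ} {n : ℕ} {ℓ : ℤ} (hℓ : 0 ≤ ℓ) {x y : Fin n → ℤ}
    (hx : inQ q x) (hy : inQ q y) :
    (∃ (z e f : Fin n → ℤ), inQ q z ∧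
        (∀ i, 0 ≤ e i ∧ e i ≤ ℓ) ∧ (∀ i, 0 ≤ f i ∧ f i ≤ ℓ) ∧
        (z = x + e ∨ z = x - e) ∧ (z = y + f ∨ z = y - f)) ↔
      du x y ≤ 2 * ℓ := by
  rw [du_le_two_mul_iff x y hℓ]
  simp only [abs_le]
  constructor
  · rintro ⟨z, e, f, -, he, hf, hze, hzf⟩
    simp only [funext_iff, Pi.add_apply, Pi.sub_apply] at hze hzf
    rcases hze with hze | hze <;> rcases hzf with hzf | hzf
    · exact .inr fun i => by have := he i; have := hf i; have := hze i; have := hzf i; lia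
    · exact .inl ⟨.inr fun i => by have := he i; have := hf i; have := hze i; have := hzf i; lia,
        fun i => by have := he i; have := hf i; have := hze i; have := hzf i; lia⟩
    · exact .inl ⟨.inl fun i => by have := he i; have := hf i; have := hze i; have := hzf i; lia,
        fun i => by have := he i; have := hf i; have := hze i; have := hzf i; lia⟩
    · exact .inr fun i => by have := he i; have := hf i; have := hze i; have := hzf i; lia
  · rintro (⟨hxy | hxy, hd⟩ | hd)
    · refine ⟨fun i => (x i + y i) / 2, fun i => x i - (x i + y i) / 2,
        fun i => (x i + y i) / 2 - y i, fun i => ?_, fun i => ?_, fun i => ?_,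
        .inr (funext fun i => ?_), .inl (funext fun i => ?_)⟩
      · have := hx i; have := hy i; lia
      · have := hxy i; have := hd i; lia
      · have := hxy i; have := hd i; lia
      · simp
      · simp
    · refine ⟨fun i => (x i + y i) / 2, fun i => (x i + y i) / 2 - x i,
        fun i => y i - (x i + y i) / 2, fun i => ?_, fun i => ?_, fun i => ?_,
        .inl (funext fun i => ?_), .inr (funext fun i => ?_)⟩
      · have := hx i; have := hy i; lia
      · have := hxy i; have := hd i; lia
      · have := hxy i; have := hd i; lia
      · simp
      · simp
    · refine ⟨fun i => max (x i) (y i), fun i => max (x i) (y i) - x i,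
        fun i => max (x i) (y i) - y i, fun i => ?_, fun i => ?_, fun i => ?_,
        .inl (funext fun i => ?_), .inl (funext fun i => ?_)⟩
      · have := hx i; have := hy i; lia
      · have := hd i; lia
      · have := hd i; lia
      · simp
      · simp

/-- `C ⊆ Q^n` is an `ℓ`-UEC code (no two distinct codewords `x, y`
admit `e, f ∈ {0,…,ℓ}^n` and a word `z ∈ Q^n` with `z ∈ {x+e, x-e}` and
`z ∈ {y+f, y-f}`) iff `d_u(x,y) ≥ 2ℓ+1` for all distinct `x, y ∈ C`. -/
theorem stmt3 (q : ℤ) (hq : 2 ≤ q) (n : ℕ) (hn : 1 ≤ n) (ℓ : ℤ) (hℓ : 0 ≤ ℓ)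
    (C : Set (Fin n → ℤ)) (hC : ∀ x ∈ C, inQ q x) :
    (∀ x ∈ C, ∀ y ∈ C, x ≠ y →
        ¬ ∃ (z e f : Fin n → ℤ), inQ q z ∧
            (∀ i, 0 ≤ e i ∧ e i ≤ ℓ) ∧ (∀ i, 0 ≤ f i ∧ f i ≤ ℓ) ∧
            (z = x + e ∨ z = x - e) ∧ (z = y + f ∨ z = y - f)) ↔
      (∀ x ∈ C, ∀ y ∈ C, x ≠ y → 2 * ℓ + 1 ≤ du x y) := by
  refine forall₂_congr fun x hx => forall₂_congr fun y hy => forall_congr' fun _ => ?_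
  rw [exists_common_word_iff hℓ (hC x hx) (hC y hy)]
  lia
end

section
/- Let q ≥ 2 be an integer and ℓ ∈ {0,1,…,q−1}. There exists a constant c > 0 such that for every integer n ≥ 1, A_u(n,ℓ)_q ≥ c · (1/√n) · ⌈q/(ℓ+1)⌉^n. -/
open Finset Filter

lemma natAbs_sub_le_dmax {n : ℕ} (x y : Fin n → ℤ) (i : Fin n) :
    ((x i - y i).natAbs : ℤ) ≤ dmax x y := by
  unfold dmax
  exact_mod_cast Finset.le_sup (f := fun i => (x i - y i).natAbs) (Finset.mem_univ i)

lemma card_le_Au {q : ℤ} {n : ℕ} {ℓ : ℤ} (C : Finset (Fin n → ℤ)) (hQ : ∀ x ∈ C, inQ q x)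
    (hd : ∀ x ∈ C, ∀ y ∈ C, x ≠ y → 2 * ℓ + 1 ≤ du x y) : C.card ≤ Au q n ℓ := by
  refine le_csSup ⟨(Fintype.piFinset fun _ : Fin n => Finset.Icc 0 (q - 1)).card, ?_⟩
    ⟨C, hQ, hd, rfl⟩
  rintro k ⟨D, hD, -, rfl⟩
  refine Finset.card_le_card fun x hx => ?_
  rw [Fintype.mem_piFinset]
  exact fun i => Finset.mem_Icc.2 (hD x hx i)

/-- Incomparable words whose coordinates are multiples of `ℓ + 1` are far apart. -/
lemma two_mul_add_one_le_du {n : ℕ} {ℓ : ℤ} (hℓ : 0 ≤ ℓ) {u v : Fin n → ℤ} (huv : u ≠ v)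
    (hsum : ∑ i, u i = ∑ i, v i) :
    2 * ℓ + 1 ≤ du (fun i => (ℓ + 1) * u i) (fun i => (ℓ + 1) * v i) := by
  have hpos : 0 < ℓ + 1 := by omega
  unfold du
  rw [if_neg]
  · obtain ⟨i, hi⟩ := Function.ne_iff.1 huv
    have h := natAbs_sub_le_dmax (fun i => (ℓ + 1) * u i) (fun i => (ℓ + 1) * v i) i
    have h1 : 1 ≤ |u i - v i| := Int.one_le_abs (sub_ne_zero.2 hi)
    simp only [Int.natCast_natAbs, ← mul_sub, abs_mul, abs_of_pos hpos] at h
    nlinarith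
  · rintro (h | h)
    · refine huv (funext fun i => ?_)
      have := (Finset.sum_eq_sum_iff_of_le
        (fun i _ => le_of_mul_le_mul_left (h i) hpos)).1 hsum.symm
      exact (this i (Finset.mem_univ i)).symm
    · refine huv (funext fun i => ?_)
      have := (Finset.sum_eq_sum_iff_of_le
        (fun i _ => le_of_mul_le_mul_left (h i) hpos)).1 hsum
      exact this i (Finset.mem_univ i)

lemma card_sum_fiber_le_Au {q ℓ : ℤ} (hℓ : 0 ≤ ℓ) {m : ℕ} (hm : (ℓ + 1) * (m - 1) ≤ q - 1)
    (n : ℕ) (s : ℤ) :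
    (Finset.univ.filter fun x : Fin n → Fin m => ∑ i, ((x i : ℕ) : ℤ) = s).card ≤ Au q n ℓ := by
  classical
  have hinj : Function.Injective
      (fun (x : Fin n → Fin m) (i : Fin n) => (ℓ + 1) * ((x i : ℕ) : ℤ)) := by
    intro x y h
    funext i
    have := mul_left_cancel₀ (by omega : ℓ + 1 ≠ 0) (congrFun h i)
    exact Fin.ext (by exact_mod_cast this)
  rw [← Finset.card_image_of_injective _ hinj]
  apply card_le_Au
  · intro x hx
    obtain ⟨u, -, rfl⟩ := Finset.mem_image.1 hx
    intro i
    have h1 : ((u i : ℕ) : ℤ) ≤ m - 1 := by have := (u i).isLt; omega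
    exact ⟨by positivity, (mul_le_mul_of_nonneg_left h1 (by omega)).trans hm⟩
  · intro x hx y hy hxy
    obtain ⟨u, hu, rfl⟩ := Finset.mem_image.1 hx
    obtain ⟨v, hv, rfl⟩ := Finset.mem_image.1 hy
    apply two_mul_add_one_le_du hℓ
    · intro h
      exact hxy (funext fun i => congrArg ((ℓ + 1) * ·) (congrFun h i))
    · exact (Finset.mem_filter.1 hu).2.trans (Finset.mem_filter.1 hv).2.symm

lemma sum_sum_apply_eq_zero {α : Type*} [Fintype α] (f : α → ℤ) (hf : ∑ a, f a = 0) (n : ℕ) :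
    ∑ x : Fin n → α, ∑ i, f (x i) = 0 := by
  induction n with
  | zero => simp
  | succ n ih =>
    rw [← (Fin.consEquiv fun _ => α).sum_comp, Fintype.sum_prod_type]
    simp [Fin.consEquiv, Fin.sum_univ_succ, Finset.sum_add_distrib, ih, ← Finset.mul_sum, hf]

lemma sum_sq_sum_apply {α : Type*} [Fintype α] (f : α → ℤ) (hf : ∑ a, f a = 0) (n : ℕ) :
    (∑ x : Fin n → α, (∑ i, f (x i)) ^ 2) * Fintype.card α
      = n * Fintype.card α ^ n * ∑ a, f a ^ 2 := by
  induction n with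
  | zero => simp
  | succ n ih =>
    rw [← (Fin.consEquiv fun _ => α).sum_comp, Fintype.sum_prod_type]
    have h0 := sum_sum_apply_eq_zero f hf n
    simp [Fin.consEquiv, Fin.sum_univ_succ, add_sq, Finset.sum_add_distrib, ← Finset.mul_sum, h0]
    linear_combination (Fintype.card α : ℤ) * ih

lemma sum_centered (m : ℕ) : ∑ a : Fin m, (2 * ((a : ℕ) : ℤ) - (m - 1)) = 0 := by
  rw [Fin.sum_univ_eq_sum_range (fun a : ℕ => 2 * (a : ℤ) - (m - 1)) m,
    Finset.sum_sub_distrib, ← Finset.mul_sum]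
  have h : ∑ i ∈ Finset.range m, (i : ℤ) * 2 = m * (m - 1) := by
    induction m with
    | zero => simp
    | succ m ih => rw [Finset.sum_range_succ, ih]; push_cast; ring
  rw [← Finset.sum_mul] at h
  simp
  linarith

/-- The second moment bound for a sum of `n` centered digits. -/
lemma sum_sq_centered_le {m : ℕ} (hm : 0 < m) (n : ℕ) :
    ∑ x : Fin n → Fin m, (∑ i, (2 * ((x i : ℕ) : ℤ) - (m - 1))) ^ 2
      ≤ n * (m : ℤ) ^ 2 * (m : ℤ) ^ n := by
  have h := sum_sq_sum_apply (fun a : Fin m => 2 * ((a : ℕ) : ℤ) - (m - 1)) (sum_centered m) n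
  have hv : ∑ a : Fin m, (2 * ((a : ℕ) : ℤ) - (m - 1)) ^ 2 ≤ m * (m : ℤ) ^ 2 := by
    calc _ ≤ ∑ _a : Fin m, (m : ℤ) ^ 2 := by
          refine Finset.sum_le_sum fun a _ => sq_le_sq' ?_ ?_ <;>
          · have := a.isLt
            omega
      _ = _ := by simp
  have hm' : (0 : ℤ) < m := by exact_mod_cast hm
  simp only [Fintype.card_fin] at h
  refine le_of_mul_le_mul_right (h.trans_le ?_) hm'
  calc _ ≤ (n : ℤ) * (m : ℤ) ^ n * (m * (m : ℤ) ^ 2) :=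
        mul_le_mul_of_nonneg_left hv (by positivity)
    _ = _ := by ring

/-- Chebyshev's inequality: at least half of all words have a digit sum near its mean. -/
lemma pow_le_two_mul_card_filter {m n : ℕ} (hm : 0 < m) (hn : 0 < n) :
    m ^ n ≤ 2 * (Finset.univ.filter fun x : Fin n → Fin m =>
      (∑ i, (2 * ((x i : ℕ) : ℤ) - (m - 1))) ^ 2 ≤ 2 * n * (m : ℤ) ^ 2).card := by
  have hcard := Finset.card_filter_add_card_filter_not (s := (Finset.univ : Finset (Fin n → Fin m)))
    (fun x : Fin n → Fin m =>
      (∑ i, (2 * ((x i : ℕ) : ℤ) - (m - 1))) ^ 2 ≤ 2 * n * (m : ℤ) ^ 2)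
  rw [Finset.card_univ, Fintype.card_fun, Fintype.card_fin, Fintype.card_fin] at hcard
  set B := Finset.univ.filter fun x : Fin n → Fin m =>
      ¬ (∑ i, (2 * ((x i : ℕ) : ℤ) - (m - 1))) ^ 2 ≤ 2 * n * (m : ℤ) ^ 2
  have hp : (0 : ℤ) < n * (m : ℤ) ^ 2 := by positivity
  have h1 : (B.card : ℤ) * (2 * n * (m : ℤ) ^ 2) ≤ n * (m : ℤ) ^ 2 * (m : ℤ) ^ n := by
    calc (B.card : ℤ) * (2 * n * (m : ℤ) ^ 2) = ∑ _x ∈ B, 2 * n * (m : ℤ) ^ 2 := by simp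
      _ ≤ ∑ x ∈ B, (∑ i, (2 * ((x i : ℕ) : ℤ) - (m - 1))) ^ 2 :=
          Finset.sum_le_sum fun x hx => (not_le.1 (Finset.mem_filter.1 hx).2).le
      _ ≤ ∑ x : Fin n → Fin m, (∑ i, (2 * ((x i : ℕ) : ℤ) - (m - 1))) ^ 2 :=
          Finset.sum_le_sum_of_subset_of_nonneg (Finset.subset_univ _)
            fun _ _ _ => sq_nonneg _
      _ ≤ _ := sum_sq_centered_le hm n
  have h2 : 2 * (B.card : ℤ) ≤ (m : ℤ) ^ n := le_of_mul_le_mul_left (by linarith) hp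
  have h3 : 2 * B.card ≤ m ^ n := by exact_mod_cast h2
  omega

lemma pow_le_mul_Au {q ℓ : ℤ} (hℓ : 0 ≤ ℓ) {m n : ℕ} (hm0 : 0 < m)
    (hm : (ℓ + 1) * (m - 1) ≤ q - 1) (hn : 0 < n) :
    m ^ n ≤ 2 * (Au q n ℓ * (2 * Nat.sqrt (2 * n * m ^ 2) + 1)) := by
  refine (pow_le_two_mul_card_filter hm0 hn).trans (Nat.mul_le_mul_left 2 ?_)
  set K := Nat.sqrt (2 * n * m ^ 2)
  have hI : (Finset.Icc (-(K : ℤ)) K).card = 2 * K + 1 := by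
    rw [Int.card_Icc]; omega
  rw [← hI]
  refine Finset.card_le_mul_card_image_of_maps_to
    (f := fun x : Fin n → Fin m => ∑ i, (2 * ((x i : ℕ) : ℤ) - (m - 1))) ?_ _ ?_
  · intro x hx
    have h := (Finset.mem_filter.1 hx).2
    set T := ∑ i, (2 * ((x i : ℕ) : ℤ) - (m - 1))
    have hT : T.natAbs ≤ K := by
      rw [Nat.le_sqrt']
      zify
      rwa [sq_abs]
    rw [Finset.mem_Icc]
    omega
  · intro t _
    by_cases ht : ∃ s : ℤ, 2 * s - n * (m - 1) = t
    · obtain ⟨s, rfl⟩ := ht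
      refine (Finset.card_le_card fun x hx => ?_).trans (card_sum_fiber_le_Au hℓ hm n s)
      have h := (Finset.mem_filter.1 hx).2
      simp only [Finset.sum_sub_distrib, ← Finset.mul_sum, Finset.sum_const, Finset.card_univ,
        Fintype.card_fin, nsmul_eq_mul] at h
      rw [Finset.mem_filter]
      exact ⟨Finset.mem_univ _, by linarith⟩
    · rw [Finset.card_eq_zero.2]
      · exact Nat.zero_le _
      · refine Finset.filter_eq_empty_iff.2 fun x _ h => ht ⟨∑ i, ((x i : ℕ) : ℤ), ?_⟩
        rw [← h]
        simp only [Finset.sum_sub_distrib, ← Finset.mul_sum, Finset.sum_const, Finset.card_univ,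
          Fintype.card_fin, nsmul_eq_mul]
        ring

/-- there is a constant `c > 0` with
`A_u(n,ℓ)_q ≥ c · (1/√n) · ⌈q/(ℓ+1)⌉^n` for all `n ≥ 1`. -/
theorem stmt6 (q : ℤ) (hq : 2 ≤ q) (ℓ : ℤ) (hℓ0 : 0 ≤ ℓ) (hℓq : ℓ ≤ q - 1) :
    ∃ c : ℝ, 0 < c ∧ ∀ n : ℕ, 1 ≤ n →
      c * (1 / Real.sqrt n) * ((⌈(q : ℚ) / ((ℓ : ℚ) + 1)⌉ : ℤ) : ℝ) ^ n
        ≤ (Au q n ℓ : ℝ) := by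
  have hℓ : (0 : ℚ) < (ℓ : ℚ) + 1 := by exact_mod_cast (by omega : 0 < ℓ + 1)
  have hq0 : (0 : ℚ) < q := by exact_mod_cast (by omega : 0 < q)
  have hceil : 0 < ⌈(q : ℚ) / ((ℓ : ℚ) + 1)⌉ := Int.ceil_pos.2 (div_pos hq0 hℓ)
  have hlt := Int.ceil_lt_add_one ((q : ℚ) / ((ℓ : ℚ) + 1))
  obtain ⟨m, hm⟩ := Int.eq_ofNat_of_zero_le hceil.le
  rw [hm] at hceil hlt ⊢
  have hm0 : 0 < m := by exact_mod_cast hceil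
  have hmq : (ℓ + 1) * ((m : ℤ) - 1) ≤ q - 1 := by
    rw [← sub_lt_iff_lt_add, lt_div_iff₀ hℓ] at hlt
    have : ((m : ℤ) - 1) * (ℓ + 1) < q := by exact_mod_cast hlt
    linarith
  have hmR : (1 : ℝ) ≤ m := by exact_mod_cast hm0
  refine ⟨1 / (8 * m), by positivity, fun n hn => ?_⟩
  have hmain : (m : ℝ) ^ n ≤ 2 * (Au q n ℓ * (2 * (Nat.sqrt (2 * n * m ^ 2) : ℝ) + 1)) := by
    exact_mod_cast pow_le_mul_Au hℓ0 hm0 hmq hn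
  have hnR : (1 : ℝ) ≤ Real.sqrt n := Real.one_le_sqrt.2 (by exact_mod_cast hn)
  have hK : 2 * (Nat.sqrt (2 * n * m ^ 2) : ℝ) + 1 ≤ 4 * (m * Real.sqrt n) := by
    have h1 : ((Nat.sqrt (2 * n * m ^ 2) : ℝ)) ≤ 3 / 2 * (m * Real.sqrt n) := by
      refine abs_le_of_sq_le_sq' ?_ (by positivity) |>.2
      have : ((Nat.sqrt (2 * n * m ^ 2) : ℝ)) ^ 2 ≤ 2 * n * m ^ 2 := by
        exact_mod_cast Nat.sqrt_le' (2 * n * m ^ 2)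
      rw [mul_pow, mul_pow, Real.sq_sqrt (Nat.cast_nonneg n)]
      have : (0 : ℝ) ≤ n * m ^ 2 := by positivity
      linarith
    have h2 : 1 ≤ m * Real.sqrt n := one_le_mul_of_one_le_of_one_le hmR hnR
    linarith
  have hfin : (m : ℝ) ^ n ≤ Au q n ℓ * (8 * m * Real.sqrt n) := by
    have := mul_le_mul_of_nonneg_left hK (Nat.cast_nonneg (α := ℝ) (Au q n ℓ))
    linarith
  have hpos : 0 < 8 * (m : ℝ) * Real.sqrt n := by positivity
  calc _ = (m : ℝ) ^ n / (8 * m * Real.sqrt n) := by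
        push_cast
        field_simp
    _ ≤ _ := (div_le_iff₀ hpos).2 hfin
end

section
/- Let n ≥ 1, ℓ ≥ 1 and q be integers with q > ℓ + 1. Then (ℓ/(q−1)) · (q/(ℓ+1))^n ≤ LA_u(n,ℓ)_q ≤ ⌈q/(ℓ+1)⌉^{n−1}, where the lower bound is an inequality of real numbers. -/
open Finset Filter

lemma abs_sub_le_dmax {n : ℕ} (x y : Fin n → ℤ) (i : Fin n) : |x i - y i| ≤ dmax x y := by
  rw [Int.abs_eq_natAbs, dmax, Nat.cast_le]
  exact Finset.le_sup (f := fun i => (x i - y i).natAbs) (Finset.mem_univ i)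

lemma dmax_le {n : ℕ} {x y : Fin n → ℤ} {ℓ : ℤ} (hℓ : 0 ≤ ℓ) (h : ∀ i, |x i - y i| ≤ ℓ) :
    dmax x y ≤ ℓ := by
  lift ℓ to ℕ using hℓ
  unfold dmax
  norm_cast
  refine Finset.sup_le fun i _ => ?_
  have := h i
  rw [Int.abs_eq_natAbs] at this
  exact_mod_cast this

lemma du_le_two_mul_dmax {n : ℕ} (x y : Fin n → ℤ) : du x y ≤ 2 * dmax x y := by
  have : 0 ≤ dmax x y := Int.natCast_nonneg _
  unfold du
  split_ifs <;> omega

/-- Expansions in base `ℓ + 1` with digits of absolute value at most `ℓ` represent zero uniquely. -/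
lemma eq_zero_of_sum_pow_mul_eq_zero {ℓ : ℤ} {n : ℕ} (z : Fin n → ℤ) (hz : ∀ i, |z i| ≤ ℓ)
    (h : ∑ i : Fin n, (ℓ + 1) ^ (i : ℕ) * z i = 0) : z = 0 := by
  induction n with
  | zero => exact Subsingleton.elim _ _
  | succ n ih =>
    have hℓ : 0 ≤ ℓ := (abs_nonneg _).trans (hz 0)
    have hsum : z 0 + (ℓ + 1) * ∑ i : Fin n, (ℓ + 1) ^ (i : ℕ) * z i.succ = 0 := by
      rw [← h, Fin.sum_univ_succ, Finset.mul_sum]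
      simp [pow_succ', mul_assoc]
    have hdvd : ℓ + 1 ∣ z 0 := by
      rw [eq_neg_of_add_eq_zero_left hsum]
      exact (dvd_mul_right _ _).neg_right
    have h0 : z 0 = 0 := Int.eq_zero_of_abs_lt_dvd hdvd (by linarith [hz 0])
    rw [h0, zero_add, mul_eq_zero] at hsum
    have htail := ih (fun i => z i.succ) (fun i => hz _) (hsum.resolve_left (by omega))
    funext i
    refine Fin.cases h0 (fun j => congrFun htail j) i

/-- The solutions of `Σ (ℓ+1)^i x_i = a` are pairwise at `du`-distance at least `2ℓ+1`. -/
lemma two_mul_add_one_le_du_of_sum_pow_eq {ℓ : ℤ} (hℓ : 0 ≤ ℓ) {n : ℕ} {x y : Fin n → ℤ}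
    (hxy : x ≠ y)
    (h : ∑ i : Fin n, (ℓ + 1) ^ (i : ℕ) * x i = ∑ i : Fin n, (ℓ + 1) ^ (i : ℕ) * y i) :
    2 * ℓ + 1 ≤ du x y := by
  have hpos : ∀ i : Fin n, (0 : ℤ) < (ℓ + 1) ^ (i : ℕ) := fun i => by positivity
  have eq_of_le : ∀ u v : Fin n → ℤ, (∀ i, u i ≤ v i) →
      ∑ i : Fin n, (ℓ + 1) ^ (i : ℕ) * u i = ∑ i : Fin n, (ℓ + 1) ^ (i : ℕ) * v i → u = v := by
    intro u v huv huv'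
    have := (Finset.sum_eq_sum_iff_of_le fun i _ =>
      mul_le_mul_of_nonneg_left (huv i) (hpos i).le).1 huv'
    funext i
    exact mul_left_cancel₀ (hpos i).ne' (this i (Finset.mem_univ i))
  have hinc : ¬((∀ i, y i ≤ x i) ∨ (∀ i, x i ≤ y i)) := by
    rintro (h1 | h1)
    · exact hxy (eq_of_le y x h1 h.symm).symm
    · exact hxy (eq_of_le x y h1 h)
  have hd : ℓ < dmax x y := by
    by_contra! hd
    have := eq_zero_of_sum_pow_mul_eq_zero (x - y)
      (fun i => (abs_sub_le_dmax x y i).trans hd)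
      (by simp only [Pi.sub_apply, mul_sub, Finset.sum_sub_distrib, h, sub_self])
    exact hxy (sub_eq_zero.1 this)
  unfold du
  rw [if_neg hinc]
  omega

/-- A linear equation over `ℤ/m` with coprime coefficients has at most `m^(n-1)` solutions. -/
lemma card_zmod_solutions_le {m : ℕ} [NeZero m] {n : ℕ} (c b : Fin n → ZMod m)
    (hb : ∑ i, c i * b i = 1) (a : ZMod m) :
    #{s : Fin n → ZMod m | ∑ i, c i * s i = a} * m ≤ m ^ n := by
  have key : #((Finset.univ.filter fun s : Fin n → ZMod m => ∑ i, c i * s i = a) ×ˢ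
      (Finset.univ : Finset (ZMod m))) ≤
      #(Finset.univ : Finset (Fin n → ZMod m)) := by
    refine Finset.card_le_card_of_injOn (fun p i => p.1 i + p.2 * b i) (fun _ _ => by simp) ?_
    have hval : ∀ (s : Fin n → ZMod m) (t : ZMod m),
        ∑ i, c i * (s i + t * b i) = ∑ i, c i * s i + t := by
      intro s t
      calc ∑ i, c i * (s i + t * b i) = ∑ i, c i * s i + t * ∑ i, c i * b i := by
            rw [Finset.mul_sum, ← Finset.sum_add_distrib]
            exact Finset.sum_congr rfl fun i _ => by ring
        _ = _ := by rw [hb, mul_one]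
    rintro ⟨s, t⟩ hs ⟨s', t'⟩ hs' heq
    simp only [Finset.coe_product, Set.mem_prod, Finset.mem_coe, Finset.mem_filter,
      Finset.mem_univ, true_and, and_true] at hs hs'
    have ht : t = t' := by
      have := hval s t
      rw [show (∑ i, c i * (s i + t * b i)) = ∑ i, c i * (s' i + t' * b i) from
        Finset.sum_congr rfl fun i _ => congrArg (c i * ·) (congrFun heq i), hval, hs, hs'] at this
      exact (add_left_cancel this).symm
    subst ht
    refine Prod.ext (funext fun i => ?_) rfl
    exact add_right_cancel (congrFun heq i)
  simpa [Finset.card_product, ZMod.card] using key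

/-- If a VT-type `ℓ`-UEC code has coprime coefficients and `q ≤ m(ℓ+1)`, then its words are
determined by their residues modulo `m`: if two of them differed by `m • z`, then adding `z` to
one of them would give another word of the code. -/
lemma eq_of_zmod_eq {q ℓ : ℤ} (hℓ : 0 ≤ ℓ) {m : ℕ} (hm : 0 < m) (hqm : q ≤ m * (ℓ + 1)) {n : ℕ}
    {C : Finset (Fin n → ℤ)} {coef : Fin n → ℤ} {a : ℤ}
    (hC : ∀ x, x ∈ C ↔ inQ q x ∧ ∑ i, coef i * x i = a)
    (hdist : ∀ x ∈ C, ∀ y ∈ C, x ≠ y → 2 * ℓ + 1 ≤ du x y)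
    {x y : Fin n → ℤ} (hx : x ∈ C) (hy : y ∈ C) (hxy : ∀ i, (x i : ZMod m) = y i) : x = y := by
  have hm' : (0 : ℤ) < m := by exact_mod_cast hm
  have hdvd : ∀ i, ∃ z : ℤ, x i - y i = m * z := fun i =>
    (ZMod.intCast_eq_intCast_iff_dvd_sub _ _ _).1 (hxy i).symm
  choose z hz using hdvd
  obtain ⟨hxQ, hxa⟩ := (hC x).1 hx
  obtain ⟨hyQ, hya⟩ := (hC y).1 hy
  have hzℓ : ∀ i, |z i| ≤ ℓ := by
    intro i
    have h1 : |x i - y i| < m * (ℓ + 1) := by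
      rw [abs_lt]
      constructor <;> linarith [(hxQ i).1, (hxQ i).2, (hyQ i).1, (hyQ i).2]
    rw [hz i, abs_mul, abs_of_pos hm'] at h1
    exact Int.lt_add_one_iff.1 (lt_of_mul_lt_mul_left h1 hm'.le)
  have hzsum : ∑ i, coef i * z i = 0 := by
    have : (m : ℤ) * ∑ i, coef i * z i = 0 := by
      rw [← sub_eq_zero.2 (hxa.trans hya.symm), ← Finset.sum_sub_distrib, Finset.mul_sum]
      exact Finset.sum_congr rfl fun i _ => by rw [← mul_sub, hz i]; ring
    exact (mul_eq_zero.1 this).resolve_left hm'.ne'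
  have hw : y + z ∈ C := by
    refine (hC _).2 ⟨fun i => ?_, ?_⟩
    · have h1 := hz i
      have := hxQ i
      have := hyQ i
      simp only [Pi.add_apply]
      rcases le_total 0 (z i) with h | h
      · have : z i ≤ m * z i := le_mul_of_one_le_left h (by omega)
        omega
      · have : m * z i ≤ z i := by nlinarith
        omega
    · simp only [Pi.add_apply, mul_add, Finset.sum_add_distrib, hya, hzsum, add_zero]
  have hz0 : y + z = y := by
    by_contra hne
    have h1 := hdist _ hw _ hy hne
    have h2 : dmax (y + z) y ≤ ℓ := dmax_le hℓ fun i => by simpa using hzℓ i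
    linarith [du_le_two_mul_dmax (y + z) y]
  funext i
  have h1 : z i = 0 := by simpa using congrFun hz0 i
  have h2 := hz i
  rw [h1, mul_zero] at h2
  exact sub_eq_zero.1 h2

lemma card_le_of_isVT {q ℓ : ℤ} (hℓ : 1 ≤ ℓ) (hq : ℓ + 1 < q) {m : ℕ} (hm : 0 < m)
    (hqm : q ≤ m * (ℓ + 1)) {n : ℕ} (hn : 1 ≤ n) {C : Finset (Fin n → ℤ)} (hVT : IsVT q C)
    (hdist : ∀ x ∈ C, ∀ y ∈ C, x ≠ y → 2 * ℓ + 1 ≤ du x y) : #C ≤ m ^ (n - 1) := by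
  obtain ⟨coef, a, hC⟩ := hVT
  rcases C.eq_empty_or_nonempty with rfl | ⟨x₀, hx₀⟩
  · simp
  have : NeZero m := ⟨hm.ne'⟩
  have : NeZero n := ⟨by omega⟩
  have hcoef : ∃ i, coef i ≠ 0 := by
    by_contra! h0
    have ha : a = 0 := by rw [← ((hC x₀).1 hx₀).2]; simp [h0]
    have hmem : ∀ x, inQ q x → x ∈ C := fun x hx => (hC x).2 ⟨hx, by simp [h0, ha]⟩
    have h1 := hdist (fun _ => 0) (hmem _ fun i => by constructor <;> simp; omega)
      (fun _ => 1) (hmem _ fun i => by constructor <;> simp; omega)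
      (fun h => by simpa using congrFun h 0)
    have h2 : dmax (fun _ : Fin n => (0 : ℤ)) (fun _ => 1) ≤ 1 :=
      dmax_le (by norm_num) fun i => by simp
    have h3 := du_le_two_mul_dmax (fun _ : Fin n => (0 : ℤ)) (fun _ => 1)
    omega
  obtain ⟨g, hg, hg1⟩ := Finset.extract_gcd coef (Finset.univ_nonempty (α := Fin n))
  set d := Finset.univ.gcd coef with hd
  have hd0 : d ≠ 0 := by
    obtain ⟨i, hi⟩ := hcoef
    intro h
    exact hi (by rw [hg i (Finset.mem_univ i), h, zero_mul])
  have hsum : ∀ x : Fin n → ℤ, ∑ i, coef i * x i = d * ∑ i, g i * x i := fun x => by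
    rw [Finset.mul_sum]
    exact Finset.sum_congr rfl fun i hi => by rw [hg i hi]; ring
  obtain ⟨b, hb⟩ := Finset.gcd_eq_sum_mul Finset.univ g
  rw [hg1] at hb
  set a' : ℤ := ∑ i, g i * x₀ i with ha'
  have hCg : ∀ x ∈ C, ∑ i, g i * x i = a' := fun x hx => by
    have h1 := ((hC x).1 hx).2
    rw [← ((hC x₀).1 hx₀).2, hsum, hsum] at h1
    exact mul_left_cancel₀ hd0 h1
  have hcard := card_zmod_solutions_le (m := m) (fun i => (g i : ZMod m))
    (fun i => (b i : ZMod m)) (by exact_mod_cast congrArg (Int.cast : ℤ → ZMod m) hb.symm) a'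
  have hle : #C ≤ #{s : Fin n → ZMod m | ∑ i, (g i : ZMod m) * s i = a'} := by
    refine Finset.card_le_card_of_injOn (fun x i => (x i : ZMod m)) (fun x hx => ?_) ?_
    · simpa using congrArg (Int.cast : ℤ → ZMod m) (hCg x hx)
    · intro x hx y hy hxy
      exact eq_of_zmod_eq (by omega) hm hqm hC hdist hx hy (congrFun hxy)
  refine hle.trans (Nat.le_of_mul_le_mul_right ?_ hm)
  rwa [← pow_succ, Nat.sub_add_cancel hn]

lemma pow_le_mul_of_card_le {q ℓ : ℤ} (hℓ : 1 ≤ ℓ) (hq : ℓ + 1 < q) {n : ℕ} {N : ℕ}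
    (hN : ∀ C : Finset (Fin n → ℤ), IsVT q C →
      (∀ x ∈ C, ∀ y ∈ C, x ≠ y → 2 * ℓ + 1 ≤ du x y) → #C ≤ N) :
    ℓ * q ^ n ≤ N * ((q - 1) * (ℓ + 1) ^ n) := by
  set S : ℤ := ∑ i : Fin n, (ℓ + 1) ^ (i : ℕ) with hS
  have hgeom : ℓ * S = (ℓ + 1) ^ n - 1 := by
    have := geom_sum_mul (ℓ + 1) n
    rw [hS, Fin.sum_univ_eq_sum_range (fun i => (ℓ + 1) ^ i) n, ← this]
    ring
  have hS0 : 0 ≤ S := Finset.sum_nonneg fun i _ => by positivity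
  set box : Finset (Fin n → ℤ) := Fintype.piFinset fun _ => Finset.Icc 0 (q - 1) with hbox
  have hmem : ∀ x, x ∈ box ↔ inQ q x := fun x => by
    simp [hbox, Fintype.mem_piFinset, inQ]
  have hcard := Finset.card_le_mul_card_image_of_maps_to
    (f := fun x : Fin n → ℤ => ∑ i : Fin n, (ℓ + 1) ^ (i : ℕ) * x i)
    (s := box) (t := Finset.Icc 0 ((q - 1) * S)) (fun x hx => by
      rw [hmem] at hx
      rw [Finset.mem_Icc]
      refine ⟨Finset.sum_nonneg fun i _ => mul_nonneg (by positivity) (hx i).1, ?_⟩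
      rw [mul_comm, hS, Finset.sum_mul]
      exact Finset.sum_le_sum fun i _ => mul_le_mul_of_nonneg_left (hx i).2 (by positivity))
    N (fun r _ => hN _ ⟨fun i => (ℓ + 1) ^ (i : ℕ), r, fun x => by simp [hmem]⟩
      fun x hx y hy hxy => by
        rw [Finset.mem_filter] at hx hy
        exact two_mul_add_one_le_du_of_sum_pow_eq (by omega) hxy (hx.2.trans hy.2.symm))
  have hQ : ((#box : ℕ) : ℤ) = q ^ n := by
    simp [hbox, Fintype.card_piFinset, Int.toNat_of_nonneg (show 0 ≤ q by omega)]
  have hI : ((#(Finset.Icc 0 ((q - 1) * S)) : ℕ) : ℤ) = (q - 1) * S + 1 := by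
    rw [Int.card_Icc, Int.toNat_of_nonneg] <;> nlinarith
  have hmain : q ^ n ≤ N * ((q - 1) * S + 1) := by
    rw [← hQ, ← hI]
    exact_mod_cast hcard
  calc ℓ * q ^ n ≤ ℓ * (N * ((q - 1) * S + 1)) := mul_le_mul_of_nonneg_left hmain (by omega)
    _ = N * ((q - 1) * (ℓ * S) + ℓ) := by ring
    _ ≤ N * ((q - 1) * (ℓ + 1) ^ n) := by
      refine mul_le_mul_of_nonneg_left ?_ (by positivity)
      rw [hgeom]
      linarith

/-- `(ℓ/(q-1))·(q/(ℓ+1))^n ≤ LA_u(n,ℓ)_q ≤ ⌈q/(ℓ+1)⌉^{n-1}`. -/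
theorem stmt12 (q ℓ : ℤ) (n : ℕ) (hn : 1 ≤ n) (hℓ : 1 ≤ ℓ) (hq : ℓ + 1 < q) :
    (ℓ : ℝ) / ((q : ℝ) - 1) * ((q : ℝ) / ((ℓ : ℝ) + 1)) ^ n ≤ (LAu q n ℓ : ℝ) ∧
    (LAu q n ℓ : ℤ) ≤ ⌈(q : ℚ) / ((ℓ : ℚ) + 1)⌉ ^ (n - 1) := by
  have hℓq : (0 : ℚ) < (ℓ : ℚ) + 1 := by exact_mod_cast (by omega : 0 < ℓ + 1)
  have hceil : 0 < ⌈(q : ℚ) / ((ℓ : ℚ) + 1)⌉ :=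
    Int.ceil_pos.2 (div_pos (by exact_mod_cast (by omega : 0 < q)) hℓq)
  obtain ⟨m, hm⟩ := Int.eq_ofNat_of_zero_le hceil.le
  have hqm : q ≤ m * (ℓ + 1) := by
    have h := Int.le_ceil ((q : ℚ) / ((ℓ : ℚ) + 1))
    rw [hm, div_le_iff₀ hℓq] at h
    exact_mod_cast h
  have hupper : m ^ (n - 1) ∈ upperBounds {k : ℕ | ∃ C : Finset (Fin n → ℤ), IsVT q C ∧
      (∀ x ∈ C, ∀ y ∈ C, x ≠ y → 2 * ℓ + 1 ≤ du x y) ∧ C.card = k} := by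
    rintro k ⟨C, hVT, hdist, rfl⟩
    exact card_le_of_isVT hℓ hq (by omega) hqm hn hVT hdist
  constructor
  · have h := pow_le_mul_of_card_le (N := LAu q n ℓ) hℓ hq fun C hVT hdist =>
      le_csSup ⟨_, hupper⟩ ⟨C, hVT, hdist, rfl⟩
    have hq1 : (0 : ℝ) < (q : ℝ) - 1 := by
      have : (1 : ℝ) < q := by exact_mod_cast (by omega : 1 < q)
      linarith
    have hℓ1 : (0 : ℝ) < (ℓ : ℝ) + 1 := by exact_mod_cast (by omega : 0 < ℓ + 1)
    rw [div_pow, div_mul_div_comm, div_le_iff₀ (by positivity)]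
    exact_mod_cast h
  · rw [hm]
    exact_mod_cast csSup_le' hupper
end

section
/- Let q ≥ 2, ℓ ≥ 0, m ≥ 1, n ≥ 1 be integers and let a, b, a_0,…,a_{m−1}, b_0,…,b_{n−1} be integers such that the codes 𝒜 = {x ∈ Q^m : Σ_{i=0}^{m−1} a_i x_i = a} and ℬ = {y ∈ Q^n : Σ_{j=0}^{n−1} b_j y_j = b} are both non-empty ℓ-UEC codes. Let M be an integer with Σ_{i=0}^{m−1} |a_i| (q−1) < M, and define 𝒞 = {z ∈ Q^{m+n} : Σ_{i=0}^{m−1} a_i z_i + Σ_{i=m}^{m+n−1} M b_{i−m} z_i = a + M b}. Then 𝒞 equals the direct product 𝒜 × ℬ = {(x; y) : x ∈ 𝒜, y ∈ ℬ} ⊆ Q^{m+n}, and 𝒜 × ℬ is an ℓ-UEC code. -/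
open Finset Filter

theorem dmax_nonneg {n : ℕ} (x y : Fin n → ℤ) : 0 ≤ dmax x y :=
  Int.natCast_nonneg _

theorem dmax_comp_le {k n : ℕ} (f : Fin k → Fin n) (u v : Fin n → ℤ) :
    dmax (u ∘ f) (v ∘ f) ≤ dmax u v := by
  unfold dmax
  refine Int.ofNat_le.mpr (Finset.sup_le fun i _ => ?_)
  exact Finset.le_sup (f := fun i => (u i - v i).natAbs) (Finset.mem_univ (f i))

/-- Restricting two words to a selection of coordinates does not increase `du`. -/
theorem du_comp_le {k n : ℕ} (f : Fin k → Fin n) (u v : Fin n → ℤ) :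
    du (u ∘ f) (v ∘ f) ≤ du u v := by
  have h := dmax_comp_le f u v
  have h0 := dmax_nonneg (u ∘ f) (v ∘ f)
  unfold du
  split_ifs with h1 h2 h2
  · exact h
  · linarith
  · exact absurd (h2.imp (fun g i => g (f i)) (fun g i => g (f i))) h1
  · linarith

theorem du_le_du_append_left {m n : ℕ} (x x' : Fin m → ℤ) (y y' : Fin n → ℤ) :
    du x x' ≤ du (Fin.append x y) (Fin.append x' y') := by
  simpa [Function.comp_def] using
    du_comp_le (Fin.castAdd n) (Fin.append x y) (Fin.append x' y')

theorem du_le_du_append_right {m n : ℕ} (x x' : Fin m → ℤ) (y y' : Fin n → ℤ) :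
    du y y' ≤ du (Fin.append x y) (Fin.append x' y') := by
  simpa [Function.comp_def] using
    du_comp_le (Fin.natAdd m) (Fin.append x y) (Fin.append x' y')

theorem inQ_append {q : ℤ} {m n : ℕ} {x : Fin m → ℤ} {y : Fin n → ℤ} :
    inQ q (Fin.append x y) ↔ inQ q x ∧ inQ q y := by
  simp [inQ, Fin.forall_fin_add]

theorem sum_append_mul_append {m n : ℕ} (c x : Fin m → ℤ) (d y : Fin n → ℤ) (M : ℤ) :
    ∑ i, Fin.append c (fun j => M * d j) i * Fin.append x y i
      = ∑ i, c i * x i + M * ∑ j, d j * y j := by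
  simp [Fin.sum_univ_add, Finset.mul_sum, mul_assoc]

theorem abs_sum_mul_sub_sum_mul_le {q : ℤ} {m : ℕ} (c : Fin m → ℤ) {x x' : Fin m → ℤ}
    (hx : inQ q x) (hx' : inQ q x') :
    |∑ i, c i * x i - ∑ i, c i * x' i| ≤ ∑ i, |c i| * (q - 1) := by
  rw [← Finset.sum_sub_distrib]
  refine (Finset.abs_sum_le_sum_abs _ _).trans (Finset.sum_le_sum fun i _ => ?_)
  rw [← mul_sub, abs_mul]
  refine mul_le_mul_of_nonneg_left (abs_le.mpr ?_) (abs_nonneg _)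
  have := hx i
  have := hx' i
  constructor <;> linarith

/-- the "product" code `𝒞` defined by the combined linear
equation equals the direct product `𝒜 × ℬ`, and `𝒜 × ℬ` is an `ℓ`-UEC code. -/
theorem stmt17 (q : ℤ) (hq : 2 ≤ q) (ℓ : ℤ) (hℓ : 0 ≤ ℓ)
    (m n : ℕ) (hm : 1 ≤ m) (hn : 1 ≤ n)
    (a b : ℤ) (ac : Fin m → ℤ) (bc : Fin n → ℤ)
    (hAne : {x : Fin m → ℤ | inQ q x ∧ ∑ i, ac i * x i = a}.Nonempty)
    (hBne : {y : Fin n → ℤ | inQ q y ∧ ∑ j, bc j * y j = b}.Nonempty)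
    (hAuec : ∀ x ∈ {x : Fin m → ℤ | inQ q x ∧ ∑ i, ac i * x i = a},
      ∀ x' ∈ {x : Fin m → ℤ | inQ q x ∧ ∑ i, ac i * x i = a},
        x ≠ x' → 2 * ℓ + 1 ≤ du x x')
    (hBuec : ∀ y ∈ {y : Fin n → ℤ | inQ q y ∧ ∑ j, bc j * y j = b},
      ∀ y' ∈ {y : Fin n → ℤ | inQ q y ∧ ∑ j, bc j * y j = b},
        y ≠ y' → 2 * ℓ + 1 ≤ du y y')
    (M : ℤ) (hM : ∑ i, |ac i| * (q - 1) < M) :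
    {z : Fin (m + n) → ℤ | inQ q z ∧
        ∑ i, Fin.append ac (fun j => M * bc j) i * z i = a + M * b}
      = {z : Fin (m + n) → ℤ |
          ∃ x ∈ {x : Fin m → ℤ | inQ q x ∧ ∑ i, ac i * x i = a},
          ∃ y ∈ {y : Fin n → ℤ | inQ q y ∧ ∑ j, bc j * y j = b},
            z = Fin.append x y} ∧
    (∀ u ∈ {z : Fin (m + n) → ℤ |
          ∃ x ∈ {x : Fin m → ℤ | inQ q x ∧ ∑ i, ac i * x i = a},
          ∃ y ∈ {y : Fin n → ℤ | inQ q y ∧ ∑ j, bc j * y j = b},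
            z = Fin.append x y},
      ∀ v ∈ {z : Fin (m + n) → ℤ |
          ∃ x ∈ {x : Fin m → ℤ | inQ q x ∧ ∑ i, ac i * x i = a},
          ∃ y ∈ {y : Fin n → ℤ | inQ q y ∧ ∑ j, bc j * y j = b},
            z = Fin.append x y},
        u ≠ v → 2 * ℓ + 1 ≤ du u v) := by
  refine ⟨Set.ext fun z => ?_, ?_⟩
  · simp only [Set.mem_ofPred_eq]
    constructor
    · rintro ⟨hz, hsum⟩
      obtain ⟨x, y, rfl⟩ : ∃ x y, z = Fin.append x y :=
        ⟨_, _, (Fin.append_castAdd_natAdd (f := z)).symm⟩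
      obtain ⟨hx, hy⟩ := inQ_append.mp hz
      rw [sum_append_mul_append] at hsum
      obtain ⟨x₀, hx₀, hx₀a⟩ := hAne
      have hlt := (abs_sum_mul_sub_sum_mul_le ac hx hx₀).trans_lt hM
      rw [hx₀a] at hlt
      have hdvd : M ∣ ∑ i, ac i * x i - a := ⟨b - ∑ j, bc j * y j, by linarith⟩
      have hxa : ∑ i, ac i * x i = a := sub_eq_zero.mp (Int.eq_zero_of_abs_lt_dvd hdvd hlt)
      have hMpos : 0 < M := (abs_nonneg _).trans_lt hlt
      refine ⟨x, ⟨hx, hxa⟩, y, ⟨hy, ?_⟩, rfl⟩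
      exact mul_left_cancel₀ hMpos.ne' (by linarith)
    · rintro ⟨x, ⟨hx, hxa⟩, y, ⟨hy, hyb⟩, rfl⟩
      exact ⟨inQ_append.mpr ⟨hx, hy⟩, by rw [sum_append_mul_append, hxa, hyb]⟩
  · rintro _ ⟨x, hx, y, hy, rfl⟩ _ ⟨x', hx', y', hy', rfl⟩ hne
    by_cases hxx : x = x'
    · have hyy : y ≠ y' := fun h => hne (by rw [hxx, h])
      exact (hBuec y hy y' hy' hyy).trans (du_le_du_append_right x x' y y')
    · exact (hAuec x hx x' hx' hxx).trans (du_le_du_append_left x x' y y')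
end
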